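/- Let (Γ, x_0) be a k-nary perfect rooted tree of height h ≥ 1 (every non-leaf vertex has outdegree k). If t = h + 1, then reg(R/I_t(Γ)) = (k^h − 1)/(k − 1); if t = h, then reg(R/I_t(Γ)) = (k^h − k)/(k − 1). -/

import Mathlib

open MvPolynomial

structure MinFreeRes (k σ : Type) [Field k] (I : Ideal (MvPolynomial σ k)) where
  b : ℕ → ℕ
  deg : (i : ℕ) → Fin (b i) → ℕ
  d : (i : ℕ) → ((Fin (b (i + 1)) → MvPolynomial σ k) →ₗ[MvPolynomial σ k]
        (Fin (b i) → MvPolynomial σ k))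
  aug : (Fin (b 0) → MvPolynomial σ k) →ₗ[MvPolynomial σ k] (MvPolynomial σ k ⧸ I)
  aug_surjective : Function.Surjective aug
  exact_zero : Function.Exact (d 0) aug
  exact_succ : ∀ i : ℕ, Function.Exact (d (i + 1)) (d i)
  aug_homog : ∀ j : Fin (b 0), ∃ p : MvPolynomial σ k,
      p.IsHomogeneous (deg 0 j) ∧ aug (Pi.single j 1) = Ideal.Quotient.mk I p
  d_homog : ∀ (i : ℕ) (j : Fin (b (i + 1))) (l : Fin (b i)),
      (d i (Pi.single j 1) l).IsHomogeneous (deg (i + 1) j - deg i l) ∧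
        (deg (i + 1) j < deg i l → d i (Pi.single j 1) l = 0)
  minimal : ∀ (i : ℕ) (j : Fin (b (i + 1))) (l : Fin (b i)),
      MvPolynomial.constantCoeff (d i (Pi.single j 1) l) = 0

/-- The Castelnuovo-Mumford regularity of the module `R/I`, defined as the supremum of
`j - i` over the nonzero graded Betti numbers `β_{i,j}(R/I)`, read off from (any)
minimal graded free resolution of `R/I`. -/
noncomputable def reg (k σ : Type) [Field k] (I : Ideal (MvPolynomial σ k)) : ℤ :=
  sSup {x : ℤ | ∃ F : MinFreeRes k σ I, ∃ i : ℕ, ∃ j : Fin (F.b i), x = (F.deg i j : ℤ) - i}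

/-- A rooted tree on the vertex set `V`, encoded by the parent function (every edge is
directed away from the root). -/
structure RTree (V : Type) where
  root : V
  parent : V → V
  parent_root : parent root = root
  reach : ∀ v : V, ∃ n : ℕ, parent^[n] v = root

namespace RTree

variable {V : Type} [Fintype V] [DecidableEq V]

/-- The level of a vertex: its distance from the root. -/
noncomputable def level (T : RTree V) (v : V) : ℕ := Nat.find (T.reach v)

/-- The height of the rooted tree: the maximal level of a vertex. -/
noncomputable def height (T : RTree V) : ℕ := Finset.univ.sup fun v => T.level v

/-- The outdegree of a vertex: its number of children. -/
noncomputable def outdeg (T : RTree V) (x : V) : ℕ :=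
  Nat.card {y : V // T.parent y = x ∧ y ≠ T.root}

/-- A leaf is a vertex with no children. -/
def IsLeaf (T : RTree V) (x : V) : Prop := ∀ y : V, T.parent y = x → y = T.root

/-- A rooted tree is perfect if every leaf has level equal to the height. -/
def Perfect (T : RTree V) : Prop := ∀ x : V, T.IsLeaf x → T.level x = T.height

/-- The monomial of the directed path on `t` vertices ending at `v`
(valid when `level v ≥ t - 1`). -/
noncomputable def pathMonomial (T : RTree V) (k : Type) [Field k] (t : ℕ) (v : V) :
    MvPolynomial V k := ∏ j ∈ Finset.range t, MvPolynomial.X (T.parent^[j] v)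

/-- The `t`-path ideal `I_t(Γ)`: generated by the monomials of directed paths on
`t` vertices. -/
noncomputable def pathIdeal (T : RTree V) (k : Type) [Field k] (t : ℕ) :
    Ideal (MvPolynomial V k) :=
  Ideal.span {m | ∃ v : V, t ≤ T.level v + 1 ∧ m = T.pathMonomial k t v}

end RTree


section Graded

variable {k σ : Type} [Field k]

/-- A vector in a graded free module is homogeneous of degree `n`. -/
def IsHomVec {ι : Type} (deg : ι → ℕ) (n : ℕ) (v : ι → MvPolynomial σ k) : Prop :=
  ∀ l, (v l).IsHomogeneous (n - deg l) ∧ (n < deg l → v l = 0)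

/-- Homogeneous component of a vector in a graded free module. -/
noncomputable def compVec {ι : Type} (deg : ι → ℕ) (n : ℕ) :
    (ι → MvPolynomial σ k) →ₗ[k] (ι → MvPolynomial σ k) :=
  LinearMap.pi fun l => if deg l ≤ n then
    (homogeneousComponent (n - deg l)).comp (LinearMap.proj l) else 0

theorem compVec_apply {ι : Type} (deg : ι → ℕ) (n : ℕ) (v : ι → MvPolynomial σ k) (l : ι) :
    compVec deg n v l = if deg l ≤ n then homogeneousComponent (n - deg l) (v l) else 0 := by
  unfold compVec
  simp only [LinearMap.pi_apply]
  split_ifs <;> simp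

theorem compVec_isHom {ι : Type} (deg : ι → ℕ) (n : ℕ) (v : ι → MvPolynomial σ k) :
    IsHomVec deg n (compVec deg n v) := by
  intro l
  rw [compVec_apply]
  split_ifs with h
  · exact ⟨homogeneousComponent_isHomogeneous _ _, fun h' => absurd h' (by omega)⟩
  · exact ⟨isHomogeneous_zero _ _ _, fun _ => rfl⟩

theorem compVec_self {ι : Type} {deg : ι → ℕ} {n : ℕ} {v : ι → MvPolynomial σ k}
    (h : IsHomVec deg n v) : compVec deg n v = v := by
  funext l
  rw [compVec_apply]
  split_ifs with h'
  · exact homogeneousComponent_eq_self (h l).1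
  · exact ((h l).2 (by omega)).symm

theorem hc_mul {p q : MvPolynomial σ k} {e : ℕ} (n : ℕ) (hq : q.IsHomogeneous e) :
    homogeneousComponent n (p * q) =
      if e ≤ n then homogeneousComponent (n - e) p * q else 0 := by
  let _ := MvPolynomial.gradedAlgebra (σ := σ) (R := k)
  have := DirectSum.coe_decompose_mul_of_right_mem (𝒜 := homogeneousSubmodule σ k) (a := p)
    (b := q) n (i := e) ((mem_homogeneousSubmodule _ _).2 hq)
  have e : ∀ (r : MvPolynomial σ k) (m : ℕ),
      (DirectSum.decompose (homogeneousSubmodule σ k) r m : MvPolynomial σ k) =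
        homogeneousComponent m r := fun r m => decomposition.decompose'_apply r m
  rw [e, e] at this
  exact this

theorem compVec_smul {ι : Type} {deg : ι → ℕ} {m : ℕ} {w : ι → MvPolynomial σ k}
    (h : IsHomVec deg m w) (n : ℕ) (r : MvPolynomial σ k) :
    compVec deg n (r • w) = if m ≤ n then homogeneousComponent (n - m) r • w else 0 := by
  funext l
  rw [compVec_apply]
  simp only [Pi.smul_apply, smul_eq_mul]
  rw [hc_mul _ (h l).1]
  by_cases h0 : m < deg l
  · have := (h l).2 h0
    simp [this]
    split_ifs <;> simp [this]
  · by_cases h1 : m ≤ n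
    · rw [if_pos (by omega), if_pos (by omega), if_pos h1]
      simp only [Pi.smul_apply, smul_eq_mul]
      congr 3
      omega
    · rw [if_neg h1]
      simp only [Pi.zero_apply]
      split_ifs with h2 h3
      · omega
      · rfl
      · rfl

theorem map_eq_sum {ι : Type} [Fintype ι] [DecidableEq ι] {M : Type} [AddCommGroup M]
    [Module (MvPolynomial σ k) M] (f : (ι → MvPolynomial σ k) →ₗ[MvPolynomial σ k] M)
    (v : ι → MvPolynomial σ k) : f v = ∑ j, v j • f (Pi.single j 1) := by
  conv_lhs => rw [pi_eq_sum_univ' v]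
  rw [map_sum]
  refine Finset.sum_congr rfl fun j _ => ?_
  rw [map_smul]

theorem map_compVec {ι κ : Type} [Fintype ι] [DecidableEq ι] {deg : ι → ℕ} {deg' : κ → ℕ}
    (f : (ι → MvPolynomial σ k) →ₗ[MvPolynomial σ k] (κ → MvPolynomial σ k))
    (hf : ∀ j, IsHomVec deg' (deg j) (f (Pi.single j 1))) (n : ℕ) (v : ι → MvPolynomial σ k) :
    f (compVec deg n v) = compVec deg' n (f v) := by
  rw [map_eq_sum f v, map_eq_sum f, map_sum]
  refine Finset.sum_congr rfl fun j _ => ?_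
  rw [compVec_smul (hf j), compVec_apply]
  split_ifs <;> simp

theorem map_isHom {ι κ : Type} [Fintype ι] [DecidableEq ι] {deg : ι → ℕ} {deg' : κ → ℕ}
    (f : (ι → MvPolynomial σ k) →ₗ[MvPolynomial σ k] (κ → MvPolynomial σ k))
    (hf : ∀ j, IsHomVec deg' (deg j) (f (Pi.single j 1))) {n : ℕ} {v : ι → MvPolynomial σ k}
    (hv : IsHomVec deg n v) : IsHomVec deg' n (f v) := by
  rw [← compVec_self hv, map_compVec f hf]
  exact compVec_isHom _ _ _

theorem sum_compVec {ι : Type} [Fintype ι] (deg : ι → ℕ) (v : ι → MvPolynomial σ k) :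
    ∃ N : ℕ, v = ∑ n ∈ Finset.range N, compVec deg n v := by
  refine ⟨(∑ l, (deg l + (v l).totalDegree)) + 1, ?_⟩
  funext l
  rw [Finset.sum_apply]
  simp only [compVec_apply]
  set N := (∑ l, (deg l + (v l).totalDegree)) + 1 with hN
  have hle : deg l + (v l).totalDegree ≤ ∑ l, (deg l + (v l).totalDegree) :=
    Finset.single_le_sum (f := fun l => deg l + (v l).totalDegree) (fun _ _ => Nat.zero_le _)
      (Finset.mem_univ l)
  obtain ⟨M, hM⟩ : ∃ M, N = deg l + (v l).totalDegree + 1 + M := ⟨N - (deg l + (v l).totalDegree + 1), by omega⟩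
  rw [hM, Finset.sum_range_add, add_assoc (deg l), Finset.sum_range_add]
  have h1 : ∑ x ∈ Finset.range (deg l), (if deg l ≤ x then homogeneousComponent (x - deg l) (v l)
      else 0) = 0 := Finset.sum_eq_zero fun x hx => by
    rw [if_neg (by simpa using hx)]
  have h3 : ∑ x ∈ Finset.range M, (if deg l ≤ deg l + ((v l).totalDegree + 1) + x then
      homogeneousComponent (deg l + ((v l).totalDegree + 1) + x - deg l) (v l)
      else 0) = 0 := Finset.sum_eq_zero fun x hx => by
    rw [if_pos (by omega)]
    exact homogeneousComponent_eq_zero _ _ (by omega)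
  rw [h1, h3, zero_add, add_zero]
  conv_lhs => rw [← sum_homogeneousComponent (v l)]
  refine Finset.sum_congr rfl fun x _ => ?_
  rw [if_pos (by omega)]
  congr 2
  omega

/-- lifting through a free module -/
theorem free_lift {ι : Type} [Fintype ι] [DecidableEq ι] {A M : Type} [AddCommGroup A]
    [Module (MvPolynomial σ k) A] [AddCommGroup M]
    [Module (MvPolynomial σ k) M] (p : A →ₗ[MvPolynomial σ k] M)
    (f : (ι → MvPolynomial σ k) →ₗ[MvPolynomial σ k] M) (P : ι → A → Prop)
    (h : ∀ j, ∃ a, P j a ∧ p a = f (Pi.single j 1)) :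
    ∃ g : (ι → MvPolynomial σ k) →ₗ[MvPolynomial σ k] A,
      p ∘ₗ g = f ∧ ∀ j, P j (g (Pi.single j 1)) := by
  choose a ha hpa using h
  have key : ∀ j, (Pi.basisFun (MvPolynomial σ k) ι).constr (MvPolynomial σ k) a (Pi.single j 1)
      = a j := by
    intro j
    have := (Pi.basisFun (MvPolynomial σ k) ι).constr_basis (MvPolynomial σ k) a j
    simp
  refine ⟨(Pi.basisFun (MvPolynomial σ k) ι).constr (MvPolynomial σ k) a, ?_, ?_⟩
  · refine (Pi.basisFun (MvPolynomial σ k) ι).ext fun j => ?_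
    rw [Pi.basisFun_apply, LinearMap.comp_apply, key, hpa]
  · intro j
    rw [key]; exact ha j

/-- A (not necessarily minimal) graded free resolution. -/
structure GRes (k σ : Type) [Field k] (I : Ideal (MvPolynomial σ k)) where
  ι : ℕ → Type
  fin : ∀ i, Fintype (ι i)
  dec : ∀ i, DecidableEq (ι i)
  deg : ∀ i, ι i → ℕ
  d : ∀ i, (ι (i + 1) → MvPolynomial σ k) →ₗ[MvPolynomial σ k] (ι i → MvPolynomial σ k)
  aug : (ι 0 → MvPolynomial σ k) →ₗ[MvPolynomial σ k] (MvPolynomial σ k ⧸ I)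
  aug_surjective : Function.Surjective aug
  exact_zero : Function.Exact (d 0) aug
  exact_succ : ∀ i : ℕ, Function.Exact (d (i + 1)) (d i)
  aug_homog : ∀ j : ι 0, ∃ p : MvPolynomial σ k,
      p.IsHomogeneous (deg 0 j) ∧ aug (Pi.single j 1) = Ideal.Quotient.mk I p
  d_homog : ∀ i j, IsHomVec (deg i) (deg (i + 1) j) (d i (Pi.single j 1))

attribute [instance] GRes.fin GRes.dec

namespace GRes

variable {I : Ideal (MvPolynomial σ k)}

/-- cycles -/
noncomputable def Z (F : GRes k σ I) : (i : ℕ) → Submodule (MvPolynomial σ k) (F.ι i → MvPolynomial σ k)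
  | 0 => LinearMap.ker F.aug
  | i + 1 => LinearMap.ker (F.d i)

theorem mem_Z (F : GRes k σ I) (i : ℕ) (v : F.ι i → MvPolynomial σ k) :
    v ∈ F.Z i ↔ ∃ w, F.d i w = v := by
  cases i with
  | zero => exact F.exact_zero v
  | succ i => exact F.exact_succ i v

theorem d_mem_Z (F : GRes k σ I) (i : ℕ) (w) : F.d i w ∈ F.Z i := (F.mem_Z i _).2 ⟨w, rfl⟩

theorem d_d (F : GRes k σ I) (i : ℕ) (w) : F.d i (F.d (i + 1) w) = 0 := F.d_mem_Z (i + 1) w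

theorem exists_seq {S : ℕ → Type} (rel : ∀ i, S i → S (i + 1) → Prop) (x0 : S 0)
    (h : ∀ i x, ∃ y, rel i x y) : ∃ f : ∀ i, S i, f 0 = x0 ∧ ∀ i, rel i (f i) (f (i + 1)) := by
  choose nx hnx using h
  exact ⟨fun i => Nat.rec x0 (fun i x => nx i x) i, rfl, fun i => hnx i _⟩

/-- surjectivity of the augmentation in graded form -/
theorem aug_lift (F : GRes k σ I) (hI : ∀ n p, p ∈ I → homogeneousComponent n p ∈ I)
    {n : ℕ} {p : MvPolynomial σ k} (hp : p.IsHomogeneous n) :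
    ∃ w, IsHomVec (F.deg 0) n w ∧ F.aug w = Ideal.Quotient.mk I p := by
  choose q hq hq' using F.aug_homog
  obtain ⟨w, hw⟩ := F.aug_surjective (Ideal.Quotient.mk I p)
  have e : ∀ w, F.aug w = Ideal.Quotient.mk I (∑ j, w j * q j) := by
    intro w
    rw [map_eq_sum F.aug w, map_sum]
    refine Finset.sum_congr rfl fun j _ => ?_
    rw [hq', map_mul]; rfl
  refine ⟨compVec (F.deg 0) n w, compVec_isHom _ _ _, ?_⟩
  rw [e] at hw ⊢
  rw [Ideal.Quotient.eq] at hw ⊢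
  have := hI n _ hw
  rw [map_sub, map_sum, homogeneousComponent_eq_self hp] at this
  convert this using 2
  refine Finset.sum_congr rfl fun j _ => ?_
  rw [hc_mul _ (hq j), compVec_apply]
  split_ifs <;> simp

/-- graded comparison map -/
theorem exists_graded_map (F G : GRes k σ I)
    (hI : ∀ n p, p ∈ I → homogeneousComponent n p ∈ I) :
    ∃ f : ∀ i, (F.ι i → MvPolynomial σ k) →ₗ[MvPolynomial σ k] (G.ι i → MvPolynomial σ k),
      G.aug ∘ₗ f 0 = F.aug ∧ (∀ i, G.d i ∘ₗ f (i + 1) = f i ∘ₗ F.d i) ∧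
      ∀ i j, IsHomVec (G.deg i) (F.deg i j) (f i (Pi.single j 1)) := by
  obtain ⟨f0, hf0, hf0'⟩ := free_lift G.aug F.aug
    (fun j w => IsHomVec (G.deg 0) (F.deg 0 j) w) (by
      intro j
      obtain ⟨p, hp, hp'⟩ := F.aug_homog j
      rw [hp']
      exact G.aug_lift hI hp)
  let S : ℕ → Type := fun i =>
    {f : (F.ι i → MvPolynomial σ k) →ₗ[MvPolynomial σ k] (G.ι i → MvPolynomial σ k) //
      (∀ j, IsHomVec (G.deg i) (F.deg i j) (f (Pi.single j 1))) ∧ ∀ v ∈ F.Z i, f v ∈ G.Z i}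
  obtain ⟨f, hfz, hf⟩ := exists_seq (S := S) (fun i f g => G.d i ∘ₗ g.1 = f.1 ∘ₗ F.d i)
    ⟨f0, hf0', fun v hv => by
      have : F.aug v = 0 := hv
      change G.aug (f0 v) = 0
      rw [← this, ← hf0]; rfl⟩
    (by
      rintro i ⟨f, hfg, hfz⟩
      obtain ⟨g, hg, hg'⟩ := free_lift (G.d i) (f ∘ₗ F.d i)
        (fun j w => IsHomVec (G.deg (i + 1)) (F.deg (i + 1) j) w) (by
          intro j
          obtain ⟨w, hw⟩ := (G.mem_Z i _).1 (hfz _ (F.d_mem_Z i (Pi.single j 1)))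
          refine ⟨compVec _ _ w, compVec_isHom _ _ _, ?_⟩
          rw [map_compVec (G.d i) (G.d_homog i), hw]
          exact compVec_self (map_isHom f hfg (F.d_homog i j)))
      refine ⟨⟨g, hg', fun v hv => ?_⟩, hg⟩
      have h1 : F.d i v = 0 := hv
      change G.d i (g v) = 0
      have : G.d i (g v) = f (F.d i v) := by
        rw [← LinearMap.comp_apply, hg]; rfl
      rw [this, h1, map_zero])
  refine ⟨fun i => (f i).1, ?_, hf, fun i => (f i).2.1⟩
  simp only [hfz]; exact hf0

/-- null-homotopy -/
theorem exists_homotopy (G : GRes k σ I)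
    (u : ∀ i, (G.ι i → MvPolynomial σ k) →ₗ[MvPolynomial σ k] (G.ι i → MvPolynomial σ k))
    (hu0 : ∀ v, G.aug (u 0 v) = 0) (hu : ∀ i v, G.d i (u (i + 1) v) = u i (G.d i v)) :
    ∃ s : ∀ i, (G.ι i → MvPolynomial σ k) →ₗ[MvPolynomial σ k] (G.ι (i + 1) → MvPolynomial σ k),
      (∀ v, G.d 0 (s 0 v) = u 0 v) ∧
      ∀ i v, G.d (i + 1) (s (i + 1) v) = u (i + 1) v - s i (G.d i v) := by
  obtain ⟨s0, hs0, -⟩ := free_lift (G.d 0) (u 0) (fun _ _ => True) (by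
    intro j
    obtain ⟨w, hw⟩ := (G.mem_Z 0 _).1 (hu0 (Pi.single j 1))
    exact ⟨w, trivial, hw⟩)
  let S : ℕ → Type := fun i =>
    {s : (G.ι i → MvPolynomial σ k) →ₗ[MvPolynomial σ k] (G.ι (i + 1) → MvPolynomial σ k) //
      ∀ v ∈ G.Z i, u i v = G.d i (s v)}
  obtain ⟨s, hsz, hs⟩ := exists_seq (S := S)
    (fun i s t => ∀ v, G.d (i + 1) (t.1 v) = u (i + 1) v - s.1 (G.d i v))
    ⟨s0, fun v hv => by rw [← hs0]; rfl⟩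
    (by
      rintro i ⟨s, hs⟩
      obtain ⟨t, ht, -⟩ := free_lift (G.d (i + 1)) (u (i + 1) - s ∘ₗ G.d i) (fun _ _ => True) (by
        intro j
        have : (u (i + 1) - s ∘ₗ G.d i) (Pi.single j 1) ∈ G.Z (i + 1) := by
          change G.d i _ = 0
          rw [LinearMap.sub_apply, map_sub, hu, LinearMap.comp_apply, hs _ (G.d_mem_Z i _),
            sub_self]
        obtain ⟨w, hw⟩ := (G.mem_Z _ _).1 this
        exact ⟨w, trivial, hw⟩)
      have ht' : ∀ v, G.d (i + 1) (t v) = u (i + 1) v - s (G.d i v) := fun v => by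
        rw [← LinearMap.comp_apply, ht]; rfl
      refine ⟨⟨t, fun v hv => ?_⟩, ht'⟩
      have h1 : G.d i v = 0 := hv
      rw [ht', h1, map_zero, sub_zero])
  refine ⟨fun i => (s i).1, fun v => ?_, hs⟩
  simp only [hsz, ← hs0]; rfl

/-- functional on the fibre at the origin -/
noncomputable def phi {ι : Type} [Fintype ι] (c : ι → k) (v : ι → MvPolynomial σ k) : k :=
  ∑ l, constantCoeff (v l) * c l

theorem phi_zero_of {ι : Type} [Fintype ι] (c : ι → k) (v : ι → MvPolynomial σ k)
    (h : ∀ l, constantCoeff (v l) = 0) : phi c v = 0 := by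
  simp [phi, h]

theorem phi_add {ι : Type} [Fintype ι] (c : ι → k) (v w : ι → MvPolynomial σ k) :
    phi c (v + w) = phi c v + phi c w := by
  simp [phi, add_mul, Finset.sum_add_distrib]

theorem phi_map {ι κ : Type} [Fintype ι] [Fintype κ] [DecidableEq κ] (c : ι → k)
    (f : (κ → MvPolynomial σ k) →ₗ[MvPolynomial σ k] (ι → MvPolynomial σ k))
    (v : κ → MvPolynomial σ k) :
    phi c (f v) = ∑ j, constantCoeff (v j) * phi c (f (Pi.single j 1)) := by
  rw [map_eq_sum f v]
  simp only [phi, Finset.sum_apply, map_sum, Pi.smul_apply, smul_eq_mul, map_mul, Finset.sum_mul,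
    Finset.mul_sum]
  rw [Finset.sum_comm]
  simp only [mul_assoc]

/-- Key comparison result: a nonzero class in the fibre of `G` forces a generator of `F`. -/
theorem exists_deg (F G : GRes k σ I)
    (hI : ∀ n p, p ∈ I → homogeneousComponent n p ∈ I) (i : ℕ) (c : G.ι i → k)
    (hc : ∀ j, phi c (G.d i (Pi.single j 1)) = 0) (z : G.ι i → MvPolynomial σ k)
    (hz : ∀ i' (h : i = i' + 1), ∀ l, constantCoeff (G.d i' (h ▸ z) l) = 0)
    (hcz : phi c z ≠ 0) : ∃ j : F.ι i, ∃ l : G.ι i, c l ≠ 0 ∧ F.deg i j = G.deg i l := by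
  obtain ⟨f, hf0, hf, hfg⟩ := exists_graded_map F G hI
  obtain ⟨g, hg0, hg, -⟩ := exists_graded_map G F hI
  obtain ⟨s, hs0, hs⟩ := G.exists_homotopy (fun i => f i ∘ₗ g i - LinearMap.id)
    (by
      intro v
      have h1 : G.aug (f 0 (g 0 v)) = G.aug v := by
        rw [← LinearMap.comp_apply, hf0, ← LinearMap.comp_apply, hg0]
      simp [h1])
    (by
      intro i v
      have h1 : G.d i (f (i + 1) (g (i + 1) v)) = f i (g i (G.d i v)) := by
        rw [← LinearMap.comp_apply, hf, LinearMap.comp_apply, ← LinearMap.comp_apply (F.d i), hg]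
        rfl
      simp [h1])
  have hcd : ∀ w, phi c (G.d i w) = 0 := by
    intro w
    rw [phi_map]
    simp [hc]
  have key : phi c (f i (g i z)) = phi c z := by
    cases i with
    | zero =>
      have h1 : f 0 (g 0 z) = z + G.d 0 (s 0 z) := by
        rw [hs0]; simp
      rw [h1, phi_add, hcd, add_zero]
    | succ i =>
      have h1 : f (i + 1) (g (i + 1) z) = z + G.d (i + 1) (s (i + 1) z) + s i (G.d i z) := by
        rw [hs]; simp only [LinearMap.sub_apply, LinearMap.comp_apply, LinearMap.id_apply]; abel
      rw [h1, phi_add, phi_add, hcd, add_zero, phi_map c (s i)]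
      have := hz i rfl
      simp only at this
      simp [this]
  rw [← key, phi_map] at hcz
  obtain ⟨j, -, hj⟩ := Finset.exists_ne_zero_of_sum_ne_zero hcz
  obtain ⟨l, -, hl⟩ := Finset.exists_ne_zero_of_sum_ne_zero (right_ne_zero_of_mul hj)
  refine ⟨j, l, right_ne_zero_of_mul hl, ?_⟩
  have h0 := left_ne_zero_of_mul hl
  obtain ⟨h1, h2⟩ := hfg i j l
  by_contra hne
  rcases lt_or_gt_of_ne hne with h | h
  · rw [h2 h, map_zero] at h0; exact h0 rfl
  · apply h0
    rw [constantCoeff_eq]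
    refine h1.coeff_eq_zero ?_
    simp only [map_zero]
    omega

end GRes

end Graded

section MinRes

variable {k σ : Type} [Field k]

/-- A graded free module with a graded submodule contained in the maximal ideal times it. -/
structure Stage (k σ : Type) [Field k] where
  b : ℕ
  deg : Fin b → ℕ
  N : Submodule (MvPolynomial σ k) (Fin b → MvPolynomial σ k)
  hN : ∀ n v, v ∈ N → compVec deg n v ∈ N
  hm : ∀ v ∈ N, ∀ l, constantCoeff (v l) = 0

/-- homogeneous generating families -/
def Stage.Gens (s : Stage k σ) (m : ℕ) : Prop :=
  ∃ (g : Fin m → (Fin s.b → MvPolynomial σ k)) (deg' : Fin m → ℕ),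
    Submodule.span (MvPolynomial σ k) (Set.range g) = s.N ∧ ∀ j, IsHomVec s.deg (deg' j) (g j)

theorem Stage.exists_gens [Finite σ] (s : Stage k σ) : ∃ m, s.Gens m := by
  set H : Set (Fin s.b → MvPolynomial σ k) := {v | v ∈ s.N ∧ ∃ n, IsHomVec s.deg n v} with hH
  have hspan : Submodule.span (MvPolynomial σ k) H = s.N := by
    apply le_antisymm
    · exact Submodule.span_le.2 fun v hv => hv.1
    · intro v hv
      obtain ⟨N, hN⟩ := sum_compVec s.deg v
      rw [hN]
      exact Submodule.sum_mem _ fun n _ => Submodule.subset_span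
        ⟨s.hN n v hv, n, compVec_isHom _ _ _⟩
  have hfg : (Submodule.span (MvPolynomial σ k) H).FG := IsNoetherian.noetherian _
  obtain ⟨t, htH, ht⟩ := (Submodule.fg_span_iff_fg_span_finset_subset H).1 hfg
  have hd : ∀ j : Fin t.card, ∃ n, IsHomVec s.deg n (t.equivFin.symm j : Fin s.b → MvPolynomial σ k) :=
    fun j => (htH (t.equivFin.symm j).2).2
  choose deg' hdeg' using hd
  refine ⟨t.card, fun j => t.equivFin.symm j, deg', ?_, hdeg'⟩
  rw [← hspan, ht]
  congr 1
  ext v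
  constructor
  · rintro ⟨j, rfl⟩
    exact (t.equivFin.symm j).2
  · intro hv
    exact ⟨t.equivFin ⟨v, hv⟩, by simp⟩

theorem Stage.step [Finite σ] (s : Stage k σ) : ∃ (m : ℕ) (deg' : Fin m → ℕ)
    (d : (Fin m → MvPolynomial σ k) →ₗ[MvPolynomial σ k] (Fin s.b → MvPolynomial σ k)),
    LinearMap.range d = s.N ∧ (∀ j, IsHomVec s.deg (deg' j) (d (Pi.single j 1))) ∧
    ∀ v, d v = 0 → ∀ l, constantCoeff (v l) = 0 := by
  classical
  have hmin : ∀ {m}, m < Nat.find s.exists_gens → ¬ s.Gens m := Nat.find_min s.exists_gens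
  obtain ⟨g, deg', hg, hdeg⟩ := Nat.find_spec s.exists_gens
  generalize Nat.find s.exists_gens = m at *
  have hsingle : ∀ j, Fintype.linearCombination (MvPolynomial σ k) g (Pi.single j 1) = g j := by
    intro j
    rw [Fintype.linearCombination_apply_single, one_smul]
  have hgr : ∀ j, IsHomVec s.deg (deg' j)
      (Fintype.linearCombination (MvPolynomial σ k) g (Pi.single j 1)) := by
    intro j; rw [hsingle]; exact hdeg j
  refine ⟨m, deg', Fintype.linearCombination (MvPolynomial σ k) g, ?_, hgr, ?_⟩
  · rw [Fintype.range_linearCombination, hg]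
  · intro v hv l
    by_contra hne
    have hw : Fintype.linearCombination (MvPolynomial σ k) g (compVec deg' (deg' l) v) = 0 := by
      rw [map_compVec _ hgr, hv, map_zero]
    have hwl : compVec deg' (deg' l) v l = C (constantCoeff (v l)) := by
      rw [compVec_apply, if_pos le_rfl, Nat.sub_self, homogeneousComponent_zero, constantCoeff_eq]
    generalize compVec deg' (deg' l) v = w at hw hwl
    generalize constantCoeff (v l) = a at hne hwl
    cases m with
    | zero => exact l.elim0
    | succ m =>
      apply hmin (Nat.lt_succ_self m)
      refine ⟨fun i => g (l.succAbove i), fun i => deg' (l.succAbove i), ?_, fun i => hdeg _⟩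
      rw [← hg]
      apply le_antisymm
      · apply Submodule.span_mono
        rintro _ ⟨i, rfl⟩
        exact ⟨_, rfl⟩
      · apply Submodule.span_le.2
        rintro _ ⟨j, rfl⟩
        by_cases hj : j = l
        · subst hj
          rw [Fintype.linearCombination_apply, Fin.sum_univ_succAbove _ j, hwl] at hw
          have h1 : g j = -((C a⁻¹ : MvPolynomial σ k) • ∑ i, w (j.succAbove i) • g (j.succAbove i)) := by
            rw [eq_neg_of_add_eq_zero_right hw, smul_neg, neg_neg, smul_smul, ← C_mul,
              inv_mul_cancel₀ hne, C_1, one_smul]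
          rw [h1]
          refine Submodule.neg_mem _ (Submodule.smul_mem _ _ (Submodule.sum_mem _ fun i _ =>
            Submodule.smul_mem _ _ (Submodule.subset_span ⟨i, rfl⟩)))
        · obtain ⟨i, rfl⟩ := Fin.exists_succAbove_eq hj
          exact Submodule.subset_span ⟨i, rfl⟩

/-- next stage of the minimal resolution -/
noncomputable def Stage.next [Finite σ] (s : Stage k σ) : Stage k σ where
  b := s.step.choose
  deg := s.step.choose_spec.choose
  N := LinearMap.ker s.step.choose_spec.choose_spec.choose
  hN := by
    intro n v hv
    have h := s.step.choose_spec.choose_spec.choose_spec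
    rw [LinearMap.mem_ker] at hv ⊢
    rw [map_compVec _ h.2.1, hv, map_zero]
  hm := fun v hv => s.step.choose_spec.choose_spec.choose_spec.2.2 v hv

/-- differential -/
noncomputable def Stage.diff [Finite σ] (s : Stage k σ) :
    (Fin s.next.b → MvPolynomial σ k) →ₗ[MvPolynomial σ k] (Fin s.b → MvPolynomial σ k) :=
  s.step.choose_spec.choose_spec.choose

theorem Stage.range_diff [Finite σ] (s : Stage k σ) : LinearMap.range s.diff = s.N :=
  s.step.choose_spec.choose_spec.choose_spec.1

theorem Stage.diff_hom [Finite σ] (s : Stage k σ) (j) :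
    IsHomVec s.deg (s.next.deg j) (s.diff (Pi.single j 1)) :=
  s.step.choose_spec.choose_spec.choose_spec.2.1 j

theorem Stage.ker_diff [Finite σ] (s : Stage k σ) : LinearMap.ker s.diff = s.next.N := rfl

/-- sequence of stages -/
noncomputable def Stage.seq [Finite σ] (s : Stage k σ) : ℕ → Stage k σ
  | 0 => s
  | n + 1 => (Stage.seq s n).next

/-- the first stage -/
noncomputable def Stage.init (I : Ideal (MvPolynomial σ k))
    (hI : ∀ n p, p ∈ I → homogeneousComponent n p ∈ I)
    (hI1 : ∀ p ∈ I, constantCoeff p = 0) : Stage k σ where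
  b := 1
  deg := fun _ => 0
  N := Submodule.comap (LinearMap.proj (0 : Fin 1) :
    (Fin 1 → MvPolynomial σ k) →ₗ[MvPolynomial σ k] MvPolynomial σ k) I
  hN := by
    intro n v hv
    have hv' : v 0 ∈ I := hv
    change compVec (fun _ => 0) n v 0 ∈ I
    rw [compVec_apply, if_pos (Nat.zero_le _)]
    exact hI _ _ hv'
  hm := by
    intro v hv l
    have hv' : v 0 ∈ I := hv
    rw [Subsingleton.elim l 0]
    exact hI1 _ hv'

theorem exists_minFreeRes [Finite σ] (I : Ideal (MvPolynomial σ k))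
    (hI : ∀ n p, p ∈ I → homogeneousComponent n p ∈ I)
    (hI1 : ∀ p ∈ I, constantCoeff p = 0) : Nonempty (MinFreeRes k σ I) := by
  let S := (Stage.init I hI hI1).seq
  have hd : ∀ i v, v ∈ (S i).N ↔ ∃ w, (S i).diff w = v := by
    intro i v
    rw [← Stage.range_diff]; rfl
  refine ⟨{
    b := fun i => (S i).b
    deg := fun i => (S i).deg
    d := fun i => (S i).diff
    aug := (Submodule.mkQ I) ∘ₗ (LinearMap.proj (0 : Fin 1) :
      (Fin 1 → MvPolynomial σ k) →ₗ[MvPolynomial σ k] MvPolynomial σ k)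
    aug_surjective := ?_
    exact_zero := ?_
    exact_succ := ?_
    aug_homog := ?_
    d_homog := ?_
    minimal := ?_ }⟩
  · intro x
    obtain ⟨p, rfl⟩ := Submodule.mkQ_surjective I x
    exact ⟨fun _ => p, rfl⟩
  · intro v
    refine Iff.trans ?_ (hd 0 v)
    change Submodule.mkQ I (v (0 : Fin 1)) = 0 ↔ v (0 : Fin 1) ∈ I
    exact Ideal.Quotient.eq_zero_iff_mem
  · intro i v
    exact hd (i + 1) v
  · intro j
    refine ⟨1, isHomogeneous_one _ _, ?_⟩
    have hj : j = (0 : Fin 1) := Subsingleton.elim (α := Fin 1) _ _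
    subst hj
    change Submodule.mkQ I ((Pi.single (0 : Fin 1) 1 : Fin 1 → MvPolynomial σ k) 0) = _
    rw [Pi.single_eq_same]
    rfl
  · intro i j l
    exact (S i).diff_hom j l
  · intro i j l
    exact (S i).hm _ ((hd i _).2 ⟨_, rfl⟩) l

/-- forget minimality -/
noncomputable def MinFreeRes.toGRes {I : Ideal (MvPolynomial σ k)} (F : MinFreeRes k σ I) : GRes k σ I where
  ι := fun i => Fin (F.b i)
  fin := fun _ => inferInstance
  dec := fun _ => inferInstance
  deg := F.deg
  d := F.d
  aug := F.aug
  aug_surjective := F.aug_surjective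
  exact_zero := F.exact_zero
  exact_succ := F.exact_succ
  aug_homog := F.aug_homog
  d_homog := fun i j l => F.d_homog i j l

theorem MinFreeRes.exists_deg {I : Ideal (MvPolynomial σ k)} (F : MinFreeRes k σ I)
    (hI : ∀ n p, p ∈ I → homogeneousComponent n p ∈ I) (G : GRes k σ I) (i : ℕ)
    (j : Fin (F.b i)) : ∃ l : G.ι i, G.deg i l = F.deg i j := by
  have hc : ∀ j', GRes.phi (Pi.single (M := fun _ => k) j (1 : k))
      (F.toGRes.d i (Pi.single j' 1)) = 0 := by
    intro j'
    apply GRes.phi_zero_of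
    intro l
    exact F.minimal i j' l
  have hz : ∀ i' (h : i = i' + 1), ∀ l, constantCoeff (F.toGRes.d i'
      (h ▸ (Pi.single (M := fun _ => MvPolynomial σ k) j 1)) l) = 0 := by
    rintro i' rfl l
    exact F.minimal i' j l
  have hcz : GRes.phi (Pi.single (M := fun _ => k) j (1 : k))
      (Pi.single (M := fun _ => MvPolynomial σ k) j 1) ≠ 0 := by
    unfold GRes.phi
    rw [Finset.sum_eq_single j]
    · simp
    · intro l _ hl
      rw [Pi.single_eq_of_ne hl, map_zero, zero_mul]
    · intro h; exact absurd (Finset.mem_univ _) h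
  obtain ⟨l, j', hj', h⟩ := GRes.exists_deg G F.toGRes hI i _ hc _ hz hcz
  have : j' = j := by
    by_contra hne
    exact hj' (Pi.single_eq_of_ne hne _)
  subst this
  exact ⟨l, h⟩

end MinRes
set_option linter.unusedSectionVars false

section Taylor

variable {k σ : Type} [Field k] {P : Type} [Fintype P] [DecidableEq P]

/-- lcm exponent of a tuple of monomials -/
noncomputable def lcmT (m : P → σ →₀ ℕ) {n : ℕ} (p : Fin n → P) : σ →₀ ℕ :=
  Finset.univ.sup fun a => m (p a)

theorem le_lcmT (m : P → σ →₀ ℕ) {n : ℕ} (p : Fin n → P) (a : Fin n) : m (p a) ≤ lcmT m p :=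
  Finset.le_sup (f := fun a => m (p a)) (Finset.mem_univ a)

theorem lcmT_le {m : P → σ →₀ ℕ} {n : ℕ} {p : Fin n → P} {u : σ →₀ ℕ} (h : ∀ a, m (p a) ≤ u) :
    lcmT m p ≤ u := Finset.sup_le fun a _ => h a

theorem lcmT_face (m : P → σ →₀ ℕ) {n : ℕ} (p : Fin (n + 1) → P) (j : Fin (n + 1)) :
    lcmT m (p ∘ j.succAbove) ≤ lcmT m p := lcmT_le fun _ => le_lcmT m p _

theorem lcmT_cons {m : P → σ →₀ ℕ} {n : ℕ} {p : Fin n → P} {q : P} {u : σ →₀ ℕ}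
    (hq : m q ≤ u) (hp : lcmT m p ≤ u) : lcmT m (Fin.cons q p : Fin (n + 1) → P) ≤ u := by
  refine lcmT_le fun a => ?_
  refine Fin.cases ?_ (fun i => ?_) a
  · simpa using hq
  · simpa using (le_lcmT m p i).trans hp

/-- monomial basis element -/
noncomputable def bas (k : Type) [Field k] (m : P → σ →₀ ℕ) {n : ℕ} (a : σ →₀ ℕ) (p : Fin n → P) :
    (Fin n → P) → MvPolynomial σ k := Pi.single p (monomial (a - lcmT m p) 1)

/-- Taylor differential on ordered tuples -/
noncomputable def tD (k : Type) [Field k] (m : P → σ →₀ ℕ) (n : ℕ) :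
    ((Fin (n + 1) → P) → MvPolynomial σ k) →ₗ[MvPolynomial σ k]
      ((Fin n → P) → MvPolynomial σ k) :=
  Fintype.linearCombination (MvPolynomial σ k) fun p =>
    ∑ j : Fin (n + 1), ((-1 : ℤ) ^ (j : ℕ)) • bas k m (lcmT m p) (p ∘ j.succAbove)

theorem tD_single (m : P → σ →₀ ℕ) (n : ℕ) (p : Fin (n + 1) → P) (r : MvPolynomial σ k) :
    tD k m n (Pi.single p r) =
      r • ∑ j : Fin (n + 1), ((-1 : ℤ) ^ (j : ℕ)) • bas k m (lcmT m p) (p ∘ j.succAbove) := by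
  unfold tD
  rw [Fintype.linearCombination_apply_single]

theorem tD_bas (m : P → σ →₀ ℕ) (n : ℕ) (p : Fin (n + 1) → P) {a : σ →₀ ℕ} (h : lcmT m p ≤ a) :
    tD k m n (bas k m a p) =
      ∑ j : Fin (n + 1), ((-1 : ℤ) ^ (j : ℕ)) • bas k m a (p ∘ j.succAbove) := by
  unfold bas
  rw [tD_single, Finset.smul_sum]
  refine Finset.sum_congr rfl fun j _ => ?_
  rw [smul_comm]
  congr 1
  unfold bas
  rw [← Pi.single_smul, smul_eq_mul, monomial_mul, one_mul]
  rw [tsub_add_tsub_cancel h (lcmT_face m p j)]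

/-- contracting homotopy -/
noncomputable def tH (k : Type) [Field k] (m : P → σ →₀ ℕ) (q : (σ →₀ ℕ) → P) (n : ℕ) :
    ((Fin n → P) → MvPolynomial σ k) →ₗ[k] ((Fin (n + 1) → P) → MvPolynomial σ k) :=
  ∑ p : Fin n → P, ((basisMonomials σ k).constr k fun u =>
    bas k m (u + lcmT m p) (Fin.cons (q (u + lcmT m p)) p : Fin (n + 1) → P)) ∘ₗ LinearMap.proj p

theorem tH_bas (m : P → σ →₀ ℕ) (q : (σ →₀ ℕ) → P) (n : ℕ) (p : Fin n → P) {a : σ →₀ ℕ}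
    (h : lcmT m p ≤ a) :
    tH k m q n (bas k m a p) = bas k m a (Fin.cons (q a) p : Fin (n + 1) → P) := by
  unfold tH
  rw [LinearMap.sum_apply, Finset.sum_eq_single p]
  · rw [LinearMap.comp_apply, LinearMap.proj_apply]
    have h1 : bas k m a p p = basisMonomials σ k (a - lcmT m p) := by
      unfold bas; rw [Pi.single_eq_same]; simp
    rw [h1, Module.Basis.constr_basis, tsub_add_cancel_of_le h]
  · intro p' _ hp'
    rw [LinearMap.comp_apply, LinearMap.proj_apply]
    unfold bas
    rw [Pi.single_eq_of_ne hp', map_zero]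
  · intro h; exact absurd (Finset.mem_univ _) h

theorem bas_ext (m : P → σ →₀ ℕ) {n : ℕ} {M : Type} [AddCommGroup M] [Module k M]
    (f g : ((Fin n → P) → MvPolynomial σ k) →ₗ[k] M)
    (h : ∀ a p, lcmT m p ≤ a → f (bas k m a p) = g (bas k m a p)) : f = g := by
  refine LinearMap.pi_ext' fun p => (basisMonomials σ k).ext fun u => ?_
  have := h (u + lcmT m p) p le_add_self
  unfold bas at this
  rw [add_tsub_cancel_right] at this
  simpa using this

theorem cons_face {n : ℕ} (q : P) (p : Fin (n + 1) → P) (i : Fin (n + 1)) :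
    (Fin.cons q p : Fin (n + 2) → P) ∘ i.succ.succAbove = Fin.cons q (p ∘ i.succAbove) := by
  funext a
  refine Fin.cases ?_ (fun b => ?_) a
  · simp
  · simp

theorem homotopy_bas (m : P → σ →₀ ℕ) (q : (σ →₀ ℕ) → P) (n : ℕ) (p : Fin (n + 1) → P)
    {a : σ →₀ ℕ} (h : lcmT m p ≤ a) (hq : m (q a) ≤ a) :
    tD k m (n + 1) (tH k m q (n + 1) (bas k m a p)) + tH k m q n (tD k m n (bas k m a p)) =
      bas k m a p := by
  rw [tH_bas m q _ p h, tD_bas _ _ _ (lcmT_cons hq h), tD_bas _ _ _ h, map_sum, Fin.sum_univ_succ,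
    add_assoc, ← Finset.sum_add_distrib, Finset.sum_eq_zero, add_zero]
  · simp only [Fin.val_zero, pow_zero, one_smul]
    congr 1
  · intro i _
    rw [cons_face, map_zsmul, tH_bas m q n _ ((lcmT_face m p i).trans h), Fin.val_succ, pow_succ,
      ← add_smul]
    simp

theorem homotopy_zero (m : P → σ →₀ ℕ) (q : (σ →₀ ℕ) → P) (p : Fin 0 → P)
    {a : σ →₀ ℕ} (hq : m (q a) ≤ a) :
    tD k m 0 (tH k m q 0 (bas k m a p)) = bas k m a p := by
  have h : lcmT m p ≤ a := lcmT_le fun i => i.elim0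
  rw [tH_bas m q _ p h, tD_bas _ _ _ (lcmT_cons hq h)]
  rw [Fin.sum_univ_succ, Fin.sum_univ_zero, add_zero]
  simp only [Fin.val_zero, pow_zero, one_smul]
  congr 1

theorem tD_tD_bas (m : P → σ →₀ ℕ) (n : ℕ) : ∀ (p : Fin (n + 2) → P) (a : σ →₀ ℕ),
    lcmT m p ≤ a → tD k m n (tD k m (n + 1) (bas k m a p)) = 0 := by
  induction n with
  | zero =>
    intro p a h
    have hp : p = (Fin.cons (p 0) (Fin.tail p)) := (Fin.cons_self_tail p).symm
    have hq : m (p 0) ≤ a := (le_lcmT m p 0).trans h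
    have h' : lcmT m (Fin.tail p) ≤ a := lcmT_le fun i => (le_lcmT m p i.succ).trans h
    have e1 : bas k m a p = tH k m (fun _ => p 0) 1 (bas k m a (Fin.tail p)) := by
      rw [tH_bas _ _ _ _ h', ← hp]
    have e2 := homotopy_bas (k := k) m (fun _ => p 0) 0 (Fin.tail p) h' hq
    have e3 := congrArg (tD k m 0) e2
    rw [e1]
    rw [map_add, tD_bas m 0 _ h'] at e3
    rw [Fin.sum_univ_succ, Fin.sum_univ_zero, add_zero] at e3
    rw [map_zsmul, map_zsmul, homotopy_zero m (fun _ => p 0) _ hq] at e3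
    simpa using e3
  | succ n ih =>
    intro p a h
    have hp : p = (Fin.cons (p 0) (Fin.tail p)) := (Fin.cons_self_tail p).symm
    have hq : m (p 0) ≤ a := (le_lcmT m p 0).trans h
    have h' : lcmT m (Fin.tail p) ≤ a := lcmT_le fun i => (le_lcmT m p i.succ).trans h
    have e1 : bas k m a p = tH k m (fun _ => p 0) (n + 2) (bas k m a (Fin.tail p)) := by
      rw [tH_bas _ _ _ _ h', ← hp]
    have e2 := homotopy_bas (k := k) m (fun _ => p 0) (n + 1) (Fin.tail p) h' hq
    have e3 := congrArg (tD k m (n + 1)) e2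
    rw [map_add] at e3
    have e4 : tD k m (n + 1) (tH k m (fun _ => p 0) (n + 1)
        (tD k m (n + 1) (bas k m a (Fin.tail p)))) + tH k m (fun _ => p 0) n
        (tD k m n (tD k m (n + 1) (bas k m a (Fin.tail p)))) =
        tD k m (n + 1) (bas k m a (Fin.tail p)) := by
      rw [tD_bas m (n + 1) _ h']
      simp only [map_sum, map_zsmul]
      rw [← Finset.sum_add_distrib]
      refine Finset.sum_congr rfl fun j _ => ?_
      rw [← smul_add, homotopy_bas m (fun _ => p 0) n _ ((lcmT_face m _ j).trans h') hq]
    rw [ih _ _ h', map_zero, add_zero] at e4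
    rw [e4] at e3
    rw [e1]
    simpa using e3

theorem tD_tD (m : P → σ →₀ ℕ) (n : ℕ) (v) : tD k m n (tD k m (n + 1) v) = 0 := by
  have := bas_ext (k := k) m ((tD k m n ∘ₗ tD k m (n + 1)).restrictScalars k) 0
    (fun a p h => tD_tD_bas m n p a h)
  exact DFunLike.congr_fun this v

theorem tD_exact [Nonempty P] (m : P → σ →₀ ℕ) (n : ℕ) :
    Function.Exact (tD k m (n + 1)) (tD k m n) := by
  classical
  let q : (σ →₀ ℕ) → P := fun a => if h : ∃ p, m p ≤ a then h.choose else Classical.arbitrary P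
  have hq : ∀ a p, m p ≤ a → m (q a) ≤ a := by
    intro a p hp
    have h : ∃ p, m p ≤ a := ⟨p, hp⟩
    simp only [q, dif_pos h]
    exact h.choose_spec
  intro v
  constructor
  · intro hv
    have := bas_ext (k := k) m (((tD k m (n + 1)).restrictScalars k) ∘ₗ tH k m q (n + 1) +
      tH k m q n ∘ₗ ((tD k m n).restrictScalars k)) LinearMap.id
      (fun a p h => homotopy_bas m q n p h (hq a (p 0) ((le_lcmT m p 0).trans h)))
    have h2 := DFunLike.congr_fun this v
    simp only [LinearMap.add_apply, LinearMap.comp_apply, LinearMap.restrictScalars_apply, hv,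
      map_zero, add_zero, LinearMap.id_apply] at h2
    exact ⟨_, h2⟩
  · rintro ⟨w, rfl⟩
    exact tD_tD m n w

theorem degree_tsub {a b : σ →₀ ℕ} (h : b ≤ a) : (a - b).degree = a.degree - b.degree := by
  have : (a - b).degree + b.degree = a.degree := by
    rw [← map_add, tsub_add_cancel_of_le h]
  omega

theorem tD_single_one_apply (m : P → σ →₀ ℕ) (n : ℕ) (p : Fin (n + 1) → P) (l : Fin n → P) :
    tD k m n (Pi.single p 1) l = ∑ j : Fin (n + 1), ((-1 : ℤ) ^ (j : ℕ)) •
      (if p ∘ j.succAbove = l then monomial (lcmT m p - lcmT m l) (1 : k) else 0) := by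
  rw [tD_single, one_smul, Finset.sum_apply]
  refine Finset.sum_congr rfl fun j _ => ?_
  rw [Pi.smul_apply]
  congr 1
  unfold bas
  split_ifs with h
  · subst h; rw [Pi.single_eq_same]
  · rw [Pi.single_eq_of_ne (Ne.symm h)]

theorem tD_hom (m : P → σ →₀ ℕ) (n : ℕ) (p : Fin (n + 1) → P) :
    IsHomVec (fun p => (lcmT m p).degree) (lcmT m p).degree (tD k m n (Pi.single p 1)) := by
  intro l
  rw [tD_single_one_apply]
  constructor
  · refine IsHomogeneous.sum _ _ _ fun j _ => ?_
    split_ifs with h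
    · have h1 : (monomial (lcmT m p - lcmT m l) (1 : k)).IsHomogeneous
          ((lcmT m p).degree - (lcmT m l).degree) := by
        apply isHomogeneous_monomial
        rw [degree_tsub]
        rw [← h]; exact lcmT_face m p j
      exact (homogeneousSubmodule σ k _).smul_of_tower_mem _ ((mem_homogeneousSubmodule _ _).2 h1)
    · rw [smul_zero]; exact isHomogeneous_zero _ _ _
  · intro hlt
    refine Finset.sum_eq_zero fun j _ => ?_
    rw [if_neg, smul_zero]
    rintro rfl
    have := Finsupp.degree_mono (lcmT_face m p j)
    simp only at hlt
    omega

/-- The Taylor-type resolution on ordered tuples. -/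
noncomputable def taylor (k : Type) [Field k] [Nonempty P] (m : P → σ →₀ ℕ) :
    GRes k σ (Ideal.span (Set.range fun p => monomial (m p) (1 : k))) where
  ι := fun n => Fin n → P
  fin := fun _ => inferInstance
  dec := fun _ => inferInstance
  deg := fun _ p => (lcmT m p).degree
  d := tD k m
  aug := (Submodule.mkQ _) ∘ₗ LinearMap.proj (Fin.elim0 : Fin 0 → P)
  aug_surjective := by
    intro x
    obtain ⟨p, rfl⟩ := Submodule.mkQ_surjective _ x
    exact ⟨fun _ => p, rfl⟩
  exact_zero := by
    have key : ∀ w : (Fin 1 → P) → MvPolynomial σ k, tD k m 0 w (Fin.elim0 : Fin 0 → P) =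
        ∑ p : Fin 1 → P, w p * monomial (m (p 0)) 1 := by
      intro w
      rw [map_eq_sum, Finset.sum_apply]
      refine Finset.sum_congr rfl fun p _ => ?_
      rw [Pi.smul_apply, smul_eq_mul, tD_single_one_apply]
      congr 1
      rw [Fin.sum_univ_succ, Fin.sum_univ_zero, add_zero, if_pos (Subsingleton.elim _ _)]
      have h1 : lcmT m p = m (p 0) := by simp [lcmT]
      have h2 : lcmT m (Fin.elim0 : Fin 0 → P) = 0 := by simp [lcmT]; rfl
      simp [h1, h2]
    intro v
    have h0 : (((Submodule.mkQ (Ideal.span (Set.range fun p => monomial (m p) (1 : k)))) ∘ₗ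
        LinearMap.proj (Fin.elim0 : Fin 0 → P)) v = 0) ↔
        v Fin.elim0 ∈ Ideal.span (Set.range fun p => monomial (m p) (1 : k)) :=
      Ideal.Quotient.eq_zero_iff_mem
    rw [h0, Ideal.mem_span_range_iff_exists_fun]
    constructor
    · rintro ⟨c, hc⟩
      refine ⟨fun p => c (p 0), ?_⟩
      funext l
      rw [Subsingleton.elim l Fin.elim0, key, ← hc]
      exact (Equiv.funUnique (Fin 1) P).sum_comp (fun p => c p * monomial (m p) 1)
    · rintro ⟨w, rfl⟩
      refine ⟨fun p => w (fun _ => p), ?_⟩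
      rw [key, ← (Equiv.funUnique (Fin 1) P).sum_comp]
      refine Finset.sum_congr rfl fun p _ => ?_
      have hp : (fun _ => (Equiv.funUnique (Fin 1) P) p : Fin 1 → P) = p := by
        funext i
        rw [Subsingleton.elim i 0]; rfl
      simp only [hp]
      rfl
  exact_succ := tD_exact m
  aug_homog := by
    intro j
    refine ⟨1, ?_, ?_⟩
    · have h2 : lcmT m j = 0 := by simp [lcmT]; rfl
      rw [h2]; simpa using isHomogeneous_one σ k
    · rw [Subsingleton.elim j Fin.elim0, LinearMap.comp_apply, LinearMap.proj_apply,
        Pi.single_eq_same]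
      rfl
  d_homog := tD_hom m

theorem span_hom (m : P → σ →₀ ℕ) (n : ℕ) (p : MvPolynomial σ k)
    (hp : p ∈ Ideal.span (Set.range fun p => monomial (m p) (1 : k))) :
    homogeneousComponent n p ∈ Ideal.span (Set.range fun p => monomial (m p) (1 : k)) := by
  let _ := MvPolynomial.gradedAlgebra (σ := σ) (R := k)
  refine homogeneousComponent_mem_of_mem (Ideal.homogeneous_span _ _ ?_) hp n
  rintro _ ⟨q, rfl⟩
  exact ⟨(m q).degree, (mem_homogeneousSubmodule _ _).2 (isHomogeneous_monomial _ rfl)⟩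

/-- indicator determinant -/
noncomputable def detB (k : Type) [Field k] {n : ℕ} (B t : Fin n → P) : k :=
  Matrix.det (Matrix.of fun a b => if t a = B b then (1 : k) else 0)

theorem detB_row {n : ℕ} {B t : Fin n → P} (h : detB k B t ≠ 0) (a : Fin n) : ∃ b, t a = B b := by
  by_contra hne
  push Not at hne
  exact h (Matrix.det_eq_zero_of_row_eq_zero a fun b => by simp [hne b])

theorem detB_col {n : ℕ} {B t : Fin n → P} (h : detB k B t ≠ 0) (b : Fin n) : ∃ a, t a = B b := by
  by_contra hne
  push Not at hne
  exact h (Matrix.det_eq_zero_of_column_eq_zero b fun a => by simp [hne a])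

theorem detB_lcm {n : ℕ} (m : P → σ →₀ ℕ) {B t : Fin n → P} (h : detB k B t ≠ 0) :
    lcmT m t = lcmT m B := by
  apply le_antisymm
  · refine lcmT_le fun a => ?_
    obtain ⟨b, hb⟩ := detB_row h a
    rw [hb]; exact le_lcmT _ _ _
  · refine lcmT_le fun b => ?_
    obtain ⟨a, ha⟩ := detB_col h b
    rw [← ha]; exact le_lcmT _ _ _

theorem detB_boundary {n : ℕ} {B : Fin n → P} (hB : Function.Injective B) (S : Fin (n + 1) → P)
    (hS : ∀ a, ∃ b, S a = B b) :
    ∑ j : Fin (n + 1), (-1 : k) ^ (j : ℕ) * detB k B (S ∘ j.succAbove) = 0 := by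
  let A : Matrix (Fin (n + 1)) (Fin (n + 1)) k :=
    Matrix.of fun a b => (Fin.cons 1 (fun b => if S a = B b then (1 : k) else 0) : Fin (n + 1) → k) b
  have h1 : A.det = ∑ j : Fin (n + 1), (-1 : k) ^ (j : ℕ) * detB k B (S ∘ j.succAbove) := by
    rw [Matrix.det_succ_column_zero]
    refine Finset.sum_congr rfl fun j _ => ?_
    have : A j 0 = 1 := by simp [A]
    rw [this, mul_one]
    congr 1
  rw [← h1]
  rw [← Matrix.exists_mulVec_eq_zero_iff]
  refine ⟨Fin.cons 1 (fun _ => -1), ?_, ?_⟩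
  · intro h
    have := congrFun h 0
    simp at this
  · funext a
    obtain ⟨b, hb⟩ := hS a
    rw [Matrix.mulVec, dotProduct, Fin.sum_univ_succ]
    simp only [A, Matrix.of_apply, Fin.cons_zero, Fin.cons_succ, mul_one, Pi.zero_apply]
    rw [Finset.sum_eq_single b]
    · simp [hb]
    · intro b' _ hb'
      rw [if_neg]; · simp
      rw [hb]; exact fun h => hb' (hB h.symm)
    · intro h; exact absurd (Finset.mem_univ _) h

theorem constantCoeff_mon_zero {u : σ →₀ ℕ} (h : u = 0) :
    constantCoeff (monomial u (1 : k)) = 1 := by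
  classical
  rw [constantCoeff_eq, coeff_monomial, if_pos h]

theorem constantCoeff_mon_ne {u : σ →₀ ℕ} (h : u ≠ 0) :
    constantCoeff (monomial u (1 : k)) = 0 := by
  classical
  rw [constantCoeff_eq, coeff_monomial, if_neg h]

theorem phi_tD (m : P → σ →₀ ℕ) (n : ℕ) (c : (Fin n → P) → k) (S : Fin (n + 1) → P) :
    GRes.phi c (tD k m n (Pi.single S 1)) = ∑ j : Fin (n + 1), (-1 : k) ^ (j : ℕ) *
      (constantCoeff (monomial (lcmT m S - lcmT m (S ∘ j.succAbove)) (1 : k)) * c (S ∘ j.succAbove)) := by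
  unfold GRes.phi
  simp only [tD_single_one_apply, map_sum, Finset.sum_mul]
  rw [Finset.sum_comm]
  refine Finset.sum_congr rfl fun j _ => ?_
  rw [Finset.sum_eq_single (S ∘ j.succAbove)]
  · rw [if_pos rfl, map_zsmul, zsmul_eq_mul]
    push_cast
    ring
  · intro l _ hl
    rw [if_neg (Ne.symm hl)]; simp
  · intro h; exact absurd (Finset.mem_univ _) h

/-- The class of a set of generators with private variables survives. -/
theorem taylor_class [Nonempty P] (m : P → σ →₀ ℕ) {n : ℕ} (B : Fin n → P)
    (hB : Function.Injective B)
    (h1 : ∀ a, ∃ y, m (B a) y ≠ 0 ∧ ∀ a', a' ≠ a → m (B a') y = 0)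
    (h2 : ∀ p, (∀ b, p ≠ B b) → ¬ m p ≤ lcmT m B)
    (F : GRes k σ (Ideal.span (Set.range fun p => monomial (m p) (1 : k)))) :
    ∃ j : F.ι n, F.deg n j = (lcmT m B).degree := by
  have hc : ∀ S, GRes.phi (detB k B) ((taylor k m).d n (Pi.single S 1)) = 0 := by
    intro S
    refine (phi_tD m n _ S).trans ?_
    by_cases hS : ∀ a, ∃ b, S a = B b
    · rw [← detB_boundary (k := k) hB S hS]
      refine Finset.sum_congr rfl fun j _ => ?_
      congr 1
      by_cases hd : detB k B (S ∘ j.succAbove) = 0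
      · rw [hd, mul_zero]
      · rw [constantCoeff_mon_zero, one_mul]
        rw [tsub_eq_zero_iff_le, detB_lcm m hd]
        refine lcmT_le fun a => ?_
        obtain ⟨b, hb⟩ := hS a
        rw [hb]; exact le_lcmT _ _ _
    · push Not at hS
      obtain ⟨a, ha⟩ := hS
      refine Finset.sum_eq_zero fun j _ => ?_
      by_cases hd : detB k B (S ∘ j.succAbove) = 0
      · rw [hd, mul_zero, mul_zero]
      · rw [constantCoeff_mon_ne, zero_mul, mul_zero]
        rw [Ne, tsub_eq_zero_iff_le, detB_lcm m hd]
        intro hle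
        exact h2 (S a) ha ((le_lcmT m S a).trans hle)
  have hz : ∀ i' (h : n = i' + 1), ∀ l, constantCoeff ((taylor k m).d i'
      (h ▸ (Pi.single (M := fun _ => MvPolynomial σ k) B 1)) l) = 0 := by
    rintro i' rfl l
    suffices h : ∀ l : Fin i' → P, constantCoeff (tD k m i' (Pi.single B 1) l) = 0 from h l
    clear l
    intro l
    rw [tD_single_one_apply, map_sum]
    refine Finset.sum_eq_zero fun j _ => ?_
    rw [map_zsmul]
    split_ifs with hj
    · rw [constantCoeff_mon_ne, smul_zero]
      rw [Ne, tsub_eq_zero_iff_le, ← hj]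
      intro hle
      obtain ⟨y, hy, hy'⟩ := h1 j
      have h3 : m (B j) ≤ lcmT m (B ∘ j.succAbove) := (le_lcmT m B j).trans hle
      have h4 : lcmT m (B ∘ j.succAbove) y = 0 := by
        unfold lcmT
        have : ∀ s : Finset (Fin i'), (s.sup fun a => m ((B ∘ j.succAbove) a)) y = 0 := by
          intro s
          induction s using Finset.induction_on with
          | empty => simp; rfl
          | insert a s _ ih =>
            rw [Finset.sup_insert, Finsupp.sup_apply, ih]
            simp [hy' _ (Fin.succAbove_ne j a)]
        exact this _
      have := h3 y
      omega
    · simp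
  have hcz : GRes.phi (detB k B) (Pi.single (M := fun _ => MvPolynomial σ k) B 1) ≠ 0 := by
    unfold GRes.phi
    rw [Finset.sum_eq_single B]
    · have : detB k B B = 1 := by
        unfold detB
        rw [← Matrix.det_one (n := Fin n)]
        congr 1
        ext a b
        simp [Matrix.one_apply, hB.eq_iff]
      simp [this]
    · intro l _ hl
      rw [Pi.single_eq_of_ne hl, map_zero, zero_mul]
    · intro h; exact absurd (Finset.mem_univ _) h
  obtain ⟨j, l, hl, hj⟩ := GRes.exists_deg F (taylor k m) (span_hom m) n (detB k B) hc _ hz hcz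
  refine ⟨j, hj.trans ?_⟩
  change (lcmT m l).degree = _
  rw [detB_lcm m hl]

/-- The regularity of a monomial ideal from tuple data. -/
theorem reg_eq_of [Finite σ] [Nonempty P] (m : P → σ →₀ ℕ) (hm : ∀ p, m p ≠ 0) {n : ℕ}
    (B : Fin n → P) (hB : Function.Injective B)
    (h1 : ∀ a, ∃ y, m (B a) y ≠ 0 ∧ ∀ a', a' ≠ a → m (B a') y = 0)
    (h2 : ∀ p, (∀ b, p ≠ B b) → ¬ m p ≤ lcmT m B) (r : ℕ)
    (hr : (lcmT m B).degree = n + r)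
    (hub : ∀ i (p : Fin i → P), (lcmT m p).degree ≤ i + r) :
    reg k σ (Ideal.span (Set.range fun p => monomial (m p) (1 : k))) = r := by
  have hI1 : ∀ p ∈ Ideal.span (Set.range fun p => monomial (m p) (1 : k)),
      constantCoeff p = 0 := by
    intro p hp
    have : Ideal.span (Set.range fun p => monomial (m p) (1 : k)) ≤
        RingHom.ker (constantCoeff (σ := σ) (R := k)) := by
      rw [Ideal.span_le]
      rintro _ ⟨q, rfl⟩
      change constantCoeff _ = 0
      rw [constantCoeff_mon_ne (hm q)]
    exact this hp
  obtain ⟨F⟩ := exists_minFreeRes _ (span_hom m) hI1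
  unfold reg
  apply IsGreatest.csSup_eq
  constructor
  · obtain ⟨j, hj⟩ := taylor_class m B hB h1 h2 F.toGRes
    refine ⟨F, n, j, ?_⟩
    have : F.deg n j = n + r := hj.trans hr
    rw [this]; push_cast; ring
  · rintro x ⟨F, i, j, rfl⟩
    obtain ⟨l, hl⟩ := F.exists_deg (span_hom m) (taylor k m) i j
    have h3 : (lcmT m l).degree = F.deg i j := hl
    have := hub i l
    omega

end Taylor

section SetVersion

variable {V : Type} [Fintype V] [DecidableEq V]

/-- exponent vector of a squarefree monomial -/
noncomputable def indF (S : Finset V) : V →₀ ℕ := ∑ v ∈ S, Finsupp.single v 1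

theorem indF_apply (S : Finset V) (y : V) : indF S y = if y ∈ S then 1 else 0 := by
  unfold indF
  rw [Finsupp.finsetSum_apply]
  simp [Finsupp.single_apply]

theorem indF_degree (S : Finset V) : (indF S).degree = S.card := by
  unfold indF
  rw [map_sum]
  simp

theorem monomial_indF {k : Type} [Field k] (S : Finset V) :
    monomial (indF S) (1 : k) = ∏ x ∈ S, X x := by
  unfold indF
  rw [monomial_sum_one]
  rfl

theorem lcmT_indF {P : Type} [Fintype P] [DecidableEq P] (S : P → Finset V) {i : ℕ} (p : Fin i → P) :
    lcmT (fun q => indF (S q)) p = indF (Finset.univ.biUnion fun a => S (p a)) := by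
  apply le_antisymm
  · apply lcmT_le
    intro a y
    simp only [indF_apply]
    by_cases h : y ∈ S (p a)
    · have : y ∈ Finset.univ.biUnion fun a => S (p a) := by
        simp only [Finset.mem_biUnion, Finset.mem_univ, true_and]; exact ⟨a, h⟩
      rw [if_pos h, if_pos this]
    · rw [if_neg h]; exact Nat.zero_le _
  · intro y
    rw [indF_apply]
    split_ifs with h
    · simp only [Finset.mem_biUnion, Finset.mem_univ, true_and] at h
      obtain ⟨a, ha⟩ := h
      have := le_lcmT (fun q => indF (S q)) p a y
      simp only [indF_apply, if_pos ha] at this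
      exact this
    · exact Nat.zero_le _

theorem reg_sets {k : Type} [Field k] {P : Type} [Fintype P] [DecidableEq P] [Nonempty P]
    (S : P → Finset V) (hS : ∀ p, (S p).Nonempty) {n : ℕ}
    (B : Fin n → P)
    (h1 : ∀ a, ∃ y ∈ S (B a), ∀ a', a' ≠ a → y ∉ S (B a'))
    (h2 : ∀ p, (∀ b, p ≠ B b) → ∃ y ∈ S p, ∀ b, y ∉ S (B b)) (r : ℕ)
    (hr : (Finset.univ.biUnion fun a => S (B a)).card = n + r)
    (hub : ∀ i (p : Fin i → P), (Finset.univ.biUnion fun a => S (p a)).card ≤ i + r) :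
    reg k V (Ideal.span (Set.range fun p => ∏ x ∈ S p, (X x : MvPolynomial V k))) = r := by
  have hB : Function.Injective B := by
    intro a a' h
    by_contra hne
    obtain ⟨y, hy, hy'⟩ := h1 a
    exact hy' a' (Ne.symm hne) (h ▸ hy)
  have := reg_eq_of (k := k) (fun q => indF (S q)) (by
    intro p h
    obtain ⟨y, hy⟩ := hS p
    have := DFunLike.congr_fun h y
    simp [indF_apply, hy] at this) B hB (by
    intro a
    obtain ⟨y, hy, hy'⟩ := h1 a
    refine ⟨y, by simp [indF_apply, hy], fun a' ha' => by simp [indF_apply, hy' a' ha']⟩) (by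
    intro p hp hle
    obtain ⟨y, hy, hy'⟩ := h2 p hp
    have := hle y
    rw [lcmT_indF] at this
    simp [indF_apply, hy, hy'] at this) r (by
    rw [lcmT_indF, indF_degree, hr]) (by
    intro i p
    rw [lcmT_indF, indF_degree]
    exact hub i p)
  simpa only [monomial_indF] using this

end SetVersion

namespace RTree

variable {V : Type} [Fintype V] [DecidableEq V] (T : RTree V)

theorem level_root : T.level T.root = 0 := by
  unfold level
  rw [Nat.find_eq_zero]
  rfl

theorem level_eq_zero {v : V} : T.level v = 0 ↔ v = T.root := by
  unfold level
  rw [Nat.find_eq_zero]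
  rfl

theorem level_parent {v : V} (hv : v ≠ T.root) : T.level v = T.level (T.parent v) + 1 := by
  apply le_antisymm
  · apply Nat.find_min'
    rw [Function.iterate_succ_apply]
    exact Nat.find_spec (T.reach (T.parent v))
  · have h0 : T.level v ≠ 0 := fun h => hv (T.level_eq_zero.1 h)
    obtain ⟨n, hn⟩ := Nat.exists_eq_succ_of_ne_zero h0
    have hs : T.parent^[T.level v] v = T.root := Nat.find_spec (T.reach v)
    rw [hn, Function.iterate_succ_apply] at hs
    have : T.level (T.parent v) ≤ n := Nat.find_min' _ hs
    omega

theorem level_iter (j : ℕ) (v : V) : T.level (T.parent^[j] v) = T.level v - j := by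
  induction j with
  | zero => rfl
  | succ j ih =>
    rw [Function.iterate_succ_apply']
    by_cases h : T.parent^[j] v = T.root
    · have : T.level (T.parent^[j] v) = 0 := T.level_eq_zero.2 h
      rw [h, T.parent_root, T.level_root]
      omega
    · have := T.level_parent h
      omega

theorem level_le (v : V) : T.level v ≤ T.height :=
  Finset.le_sup (f := fun v => T.level v) (Finset.mem_univ v)

theorem exists_level_height : ∃ v, T.level v = T.height := by
  obtain ⟨v, -, hv⟩ := Finset.exists_mem_eq_sup Finset.univ ⟨T.root, Finset.mem_univ _⟩
    (fun v => T.level v)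
  exact ⟨v, hv.symm⟩

/-- vertices of given level -/
noncomputable def lev (j : ℕ) : Finset V := Finset.univ.filter fun v => T.level v = j

theorem mem_lev {j : ℕ} {v : V} : v ∈ T.lev j ↔ T.level v = j := by simp [lev]

/-- vertices on the path with `t` vertices ending in `v` -/
noncomputable def pth (t : ℕ) (v : V) : Finset V :=
  (Finset.range t).image fun j => T.parent^[j] v

theorem mem_pth {t : ℕ} {v y : V} : y ∈ T.pth t v ↔ ∃ j < t, T.parent^[j] v = y := by
  simp [pth]

theorem pathMonomial_eq {k : Type} [Field k] {t : ℕ} {v : V} (h : t ≤ T.level v + 1) :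
    T.pathMonomial k t v = ∏ x ∈ T.pth t v, X x := by
  unfold pathMonomial pth
  rw [Finset.prod_image]
  intro i hi j hj hij
  have := congrArg T.level hij
  simp only [level_iter] at this
  simp at hi hj
  omega

theorem pathIdeal_eq (k : Type) [Field k] (t : ℕ) :
    T.pathIdeal k t = Ideal.span (Set.range fun p : {v : V // t ≤ T.level v + 1} =>
      ∏ x ∈ T.pth t p.1, (X x : MvPolynomial V k)) := by
  unfold pathIdeal
  congr 1
  ext m
  constructor
  · rintro ⟨v, hv, rfl⟩
    exact ⟨⟨v, hv⟩, (T.pathMonomial_eq hv).symm⟩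
  · rintro ⟨⟨v, hv⟩, rfl⟩
    exact ⟨v, hv, (T.pathMonomial_eq hv).symm⟩

variable {T} {c : ℕ}

theorem card_children (hnary : ∀ x : V, T.level x + 1 ≤ T.height → T.outdeg x = c)
    {x : V} (hx : T.level x + 1 ≤ T.height) :
    (Finset.univ.filter fun y => T.parent y = x ∧ y ≠ T.root).card = c := by
  rw [← hnary x hx]
  unfold outdeg
  rw [Nat.card_eq_fintype_card, Fintype.card_subtype]

theorem card_lev (hnary : ∀ x : V, T.level x + 1 ≤ T.height → T.outdeg x = c)
    (j : ℕ) (hj : j ≤ T.height) : (T.lev j).card = c ^ j := by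
  induction j with
  | zero =>
    have : T.lev 0 = {T.root} := by
      ext v; rw [mem_lev, level_eq_zero, Finset.mem_singleton]
    rw [this]; simp
  | succ j ih =>
    have hmap : ∀ v ∈ T.lev (j + 1), T.parent v ∈ T.lev j := by
      intro v hv
      rw [mem_lev] at hv ⊢
      have : v ≠ T.root := by
        rintro rfl
        rw [level_root] at hv; omega
      have := T.level_parent this
      omega
    rw [Finset.card_eq_sum_card_fiberwise hmap, pow_succ, ← ih (by omega),
      ← smul_eq_mul, ← Finset.sum_const]
    apply Finset.sum_congr rfl
    intro x hx
    rw [mem_lev] at hx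
    rw [← card_children hnary (x := x) (by omega)]
    congr 1
    ext y
    simp only [Finset.mem_filter, mem_lev, Finset.mem_univ, true_and]
    constructor
    · rintro ⟨h1, h2⟩
      refine ⟨h2, ?_⟩
      rintro rfl
      rw [level_root] at h1; omega
    · rintro ⟨h1, h2⟩
      have := T.level_parent h2
      rw [h1] at this
      exact ⟨by omega, h1⟩

theorem c_pos (hh : 1 ≤ T.height)
    (hnary : ∀ x : V, T.level x + 1 ≤ T.height → T.outdeg x = c) : 0 < c := by
  obtain ⟨v, hv⟩ := T.exists_level_height
  have h1 := card_lev hnary T.height le_rfl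
  have h2 : 0 < (T.lev T.height).card := Finset.card_pos.2 ⟨v, T.mem_lev.2 hv⟩
  rcases Nat.eq_zero_or_pos c with h | h
  · rw [h, zero_pow (by omega)] at h1; omega
  · exact h

theorem exists_desc (hh : 1 ≤ T.height)
    (hnary : ∀ x : V, T.level x + 1 ≤ T.height → T.outdeg x = c) (i : ℕ) (v : V)
    (hv : T.level v + i ≤ T.height) :
    ∃ w, T.parent^[i] w = v ∧ T.level w = T.level v + i := by
  induction i with
  | zero => exact ⟨v, rfl, rfl⟩
  | succ i ih =>
    obtain ⟨w, hw, hl⟩ := ih (by omega)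
    have h1 := card_children hnary (x := w) (by omega)
    have h2 := c_pos hh hnary
    rw [← h1, Finset.card_pos] at h2
    obtain ⟨y, hy⟩ := h2
    simp only [Finset.mem_filter, Finset.mem_univ, true_and] at hy
    refine ⟨y, by rw [Function.iterate_succ_apply, hy.1, hw], ?_⟩
    have := T.level_parent hy.2
    rw [hy.1] at this
    omega

theorem card_filter_level (hnary : ∀ x : V, T.level x + 1 ≤ T.height → T.outdeg x = c)
    (s : Finset ℕ) (hs : ∀ j ∈ s, j ≤ T.height) :
    (Finset.univ.filter fun v => T.level v ∈ s).card = ∑ j ∈ s, c ^ j := by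
  have hmap : ∀ v ∈ (Finset.univ.filter fun v => T.level v ∈ s), T.level v ∈ s := by
    intro v hv; simpa using hv
  rw [Finset.card_eq_sum_card_fiberwise hmap]
  apply Finset.sum_congr rfl
  intro j hj
  rw [← card_lev hnary j (hs j hj)]
  congr 1
  ext v
  simp only [Finset.mem_filter, mem_lev, Finset.mem_univ, true_and]
  constructor
  · exact fun h => h.2
  · intro h; exact ⟨h ▸ hj, h⟩

/-- common part of the two cases; `s` is the set of inner levels -/
theorem reg_aux {k : Type} [Field k] (hh : 1 ≤ T.height)
    (hnary : ∀ x : V, T.level x + 1 ≤ T.height → T.outdeg x = c) (t : ℕ)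
    (ht : t = T.height + 1 ∨ t = T.height) :
    reg k V (T.pathIdeal k t) = ((∑ j ∈ Finset.Ico (T.height + 1 - t) T.height, c ^ j : ℕ) : ℤ) := by
  rw [pathIdeal_eq]
  set s := Finset.Ico (T.height + 1 - t) T.height with hs
  let P := {v : V // t ≤ T.level v + 1}
  let L := {v : V // T.level v = T.height}
  have hPne : Nonempty P := by
    obtain ⟨v, hv⟩ := T.exists_level_height
    exact ⟨⟨v, by omega⟩⟩
  let n := Fintype.card L
  have hn : n = c ^ T.height := by
    rw [← card_lev hnary T.height le_rfl]
    exact Fintype.card_subtype _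
  let e : Fin n ≃ L := (Fintype.equivFin L).symm
  let B : Fin n → P := fun a => ⟨(e a).1, by have := (e a).2; omega⟩
  have hBl : ∀ a, T.level (B a).1 = T.height := fun a => (e a).2
  have hBs : ∀ v, T.level v = T.height → ∃ a, (B a).1 = v := by
    intro v hv
    refine ⟨e.symm ⟨v, hv⟩, ?_⟩
    simp [B]
  have hBi : ∀ a a', (B a).1 = (B a').1 → a = a' := by
    intro a a' h
    exact e.injective (Subtype.ext h)
  -- a level-h vertex on a path is its end
  have hend : ∀ (v y : V), y ∈ T.pth t v → T.level y = T.height → y = v := by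
    intro v y hy hl
    obtain ⟨j, hj, rfl⟩ := T.mem_pth.1 hy
    rw [level_iter] at hl
    have := T.level_le v
    have : j = 0 := by omega
    subst this
    rfl
  refine reg_sets (P := P) (fun p => T.pth t p.1) ?_ B ?_ ?_ _ ?_ ?_
  · intro p
    exact ⟨p.1, T.mem_pth.2 ⟨0, by omega, rfl⟩⟩
  · intro a
    refine ⟨(B a).1, T.mem_pth.2 ⟨0, by omega, rfl⟩, ?_⟩
    intro a' ha' hmem
    exact ha' (hBi _ _ (hend _ _ hmem (hBl a)).symm)
  · intro p hp
    have hpl : T.level p.1 ≠ T.height := by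
      intro h
      obtain ⟨a, ha⟩ := hBs _ h
      exact hp a (Subtype.ext ha.symm)
    have h1 := T.level_le p.1
    have h2 := p.2
    have h3 : t = T.height := by omega
    have h4 : T.level p.1 + 1 = t := by omega
    refine ⟨T.root, T.mem_pth.2 ⟨T.level p.1, by omega, ?_⟩, ?_⟩
    · rw [← level_eq_zero, level_iter]; omega
    · intro b hb
      obtain ⟨j, hj, hj'⟩ := T.mem_pth.1 hb
      rw [← level_eq_zero, level_iter, hBl] at hj'
      omega
  · have hU : (Finset.univ.biUnion fun a => T.pth t (B a).1) =
        Finset.univ.filter fun v => T.level v ∈ insert T.height s := by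
      ext y
      simp only [Finset.mem_biUnion, Finset.mem_univ, true_and, Finset.mem_filter,
        Finset.mem_insert, hs, Finset.mem_Ico]
      constructor
      · rintro ⟨a, ha⟩
        obtain ⟨j, hj, rfl⟩ := T.mem_pth.1 ha
        rw [level_iter, hBl]
        omega
      · intro hy
        have := T.level_le y
        obtain ⟨w, hw, hwl⟩ := exists_desc hh hnary (T.height - T.level y) y (by omega)
        obtain ⟨a, ha⟩ := hBs w (by omega)
        refine ⟨a, T.mem_pth.2 ⟨T.height - T.level y, by omega, ?_⟩⟩
        rw [ha, hw]
    rw [hU, card_filter_level hnary, Finset.sum_insert, hn]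
    · simp [hs]
    · intro j hj
      simp [hs] at hj
      omega
  · intro i p
    have hsub : (Finset.univ.biUnion fun a => T.pth t (p a).1) ⊆
        ((Finset.univ.biUnion fun a => T.pth t (p a).1).filter fun y => T.level y ∉ s) ∪
        (Finset.univ.filter fun v => T.level v ∈ s) := by
      intro y hy
      by_cases h : T.level y ∈ s
      · exact Finset.mem_union_right _ (by simpa using h)
      · exact Finset.mem_union_left _ (Finset.mem_filter.2 ⟨hy, h⟩)
    refine (Finset.card_le_card hsub).trans ((Finset.card_union_le _ _).trans ?_)
    rw [card_filter_level hnary s (by intro j hj; simp [hs] at hj; omega)]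
    apply Nat.add_le_add_right
    have hex : ∀ y ∈ ((Finset.univ.biUnion fun a => T.pth t (p a).1).filter
        fun y => T.level y ∉ s), ∃ a : Fin i, (T.level y = T.height ∧ y = (p a).1) ∨
          (T.level y ≠ T.height ∧ y = T.root ∧ T.level (p a).1 ≠ T.height) := by
      intro y hy
      simp only [Finset.mem_biUnion, Finset.mem_univ, true_and, Finset.mem_filter,
        hs, Finset.mem_Ico] at hy
      obtain ⟨⟨a, ha⟩, hys⟩ := hy
      refine ⟨a, ?_⟩
      by_cases hl : T.level y = T.height
      · exact Or.inl ⟨hl, hend _ _ ha hl⟩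
      · right
        have h1 := T.level_le y
        have h0 : T.level y = 0 := by omega
        refine ⟨hl, T.level_eq_zero.1 h0, ?_⟩
        intro hpa
        obtain ⟨j, hj, hj'⟩ := T.mem_pth.1 ha
        have := T.level_iter j (p a).1
        rw [hj', h0, hpa] at this
        omega
    rcases Nat.eq_zero_or_pos i with hi | hi
    · subst hi
      simp
    have : Nonempty (Fin i) := ⟨⟨0, hi⟩⟩
    choose! f hf using hex
    have := Finset.card_le_card_of_injOn (t := (Finset.univ : Finset (Fin i))) f (by simp) (by
      intro y hy z hz hyz
      have h1 := hf y hy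
      have h2 := hf z hz
      rw [hyz] at h1
      rcases h1 with ⟨a1, a2⟩ | ⟨a1, a2, a3⟩ <;> rcases h2 with ⟨b1, b2⟩ | ⟨b1, b2, b3⟩
      · exact a2.trans b2.symm
      · rw [a2] at a1; exact absurd a1 b3
      · rw [b2] at b1; exact absurd b1 a3
      · exact a2.trans b2.symm)
    simpa using this

end RTree

/-- Corollary 3.3: for a `c`-nary (perfect) rooted tree of height `h ≥ 1`:
if `t = h+1` then `reg(R/I_t(Γ)) = (c^h - 1)/(c - 1) = 1 + c + ⋯ + c^{h-1}`, and
if `t = h` then `reg(R/I_t(Γ)) = (c^h - c)/(c - 1) = c + ⋯ + c^{h-1}`. -/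
theorem reg_path_ideal_nary
    {k V : Type} [Field k] [Fintype V] [DecidableEq V] (T : RTree V)
    (hh : 1 ≤ T.height) (c : ℕ)
    (hnary : ∀ x : V, T.level x + 1 ≤ T.height → T.outdeg x = c) :
    reg k V (T.pathIdeal k (T.height + 1)) = ∑ i ∈ Finset.range T.height, (c : ℤ) ^ i ∧
    reg k V (T.pathIdeal k T.height) = ∑ i ∈ Finset.Ico 1 T.height, (c : ℤ) ^ i := by
  constructor
  · rw [RTree.reg_aux hh hnary _ (Or.inl rfl), Nat.sub_self, ← Finset.range_eq_Ico]
    push_cast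
    rfl
  · rw [RTree.reg_aux hh hnary _ (Or.inr rfl), Nat.add_sub_cancel_left]
    push_cast
    rfl
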